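/- Let X_S ∈ ℝ^{|S|×p} be a row submatrix of X with |S| = n − l, and suppose there is a positive definite matrix Σ ∈ ℝ^{p×p} with bounded minimum and maximum eigenvalues such that ‖X_S Σ^{-1} X_Sᵀ/p − I‖_max ≤ c·max{√(log|S|/p), log|S|/p} and ‖X_SᵀX_S/|S| − Σ‖₂ ≤ λ_min(Σ)/2. Then there exists a constant C (depending only on c and the eigenvalue bounds of Σ) such that ‖P_{X_S}^⊥ − (1 − p/(n−l))·I‖_max ≤ C·max{p, √(p·log(n−l)), log(n−l)}/(n−l). -/

import Mathlib

open Matrix MeasureTheory ProbabilityTheory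
open scoped BigOperators ENNReal

noncomputable section

namespace Debug

variable {ι κ : Type*} [Fintype ι] [Fintype κ]

/-- Squared Euclidean norm of a vector. -/
def sqNorm (v : ι → ℝ) : ℝ := ∑ i, v i ^ 2

/-- ℓ¹ norm of a vector. -/
def norm1 (v : ι → ℝ) : ℝ := ∑ i, |v i|

/-- ℓ∞ norm of a vector. -/
def normInf (v : ι → ℝ) : ℝ := ⨆ i, |v i|

/-- ℓ∞ operator norm of a matrix (maximum row ℓ¹ norm). -/
def matNormInf (M : Matrix ι κ ℝ) : ℝ := ⨆ i, ∑ j, |M i j|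

/-- Elementwise max norm of a matrix. -/
def matNormMax (M : Matrix ι κ ℝ) : ℝ := ⨆ i, ⨆ j, |M i j|

/-- Spectral norm of a matrix. -/
def specNorm (M : Matrix ι κ ℝ) : ℝ :=
  ⨆ v : {v : κ → ℝ // sqNorm v ≤ 1}, Real.sqrt (sqNorm (M.mulVec v.1))

/-- Minimum eigenvalue of a symmetric matrix, as the minimum Rayleigh quotient. -/
def minEig (M : Matrix ι ι ℝ) : ℝ :=
  ⨅ v : {v : ι → ℝ // sqNorm v = 1}, v.1 ⬝ᵥ M.mulVec v.1

/-- Maximum eigenvalue of a symmetric matrix, as the maximum Rayleigh quotient. -/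
def maxEig (M : Matrix ι ι ℝ) : ℝ :=
  ⨆ v : {v : ι → ℝ // sqNorm v = 1}, v.1 ⬝ᵥ M.mulVec v.1

variable [DecidableEq ι] [DecidableEq κ]

/-- Projection onto the column space of `A`. -/
def proj (A : Matrix ι κ ℝ) : Matrix ι ι ℝ := A * (Aᵀ * A)⁻¹ * Aᵀ

/-- Projection onto the orthogonal complement of the column space of `A`. -/
def projPerp (A : Matrix ι κ ℝ) : Matrix ι ι ℝ := 1 - proj A

variable {n m p : ℕ}

/-- The stacked design matrix `X' = [X; √(ηn/m)·X̃]`. -/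
def stackM (η : ℝ) (X : Matrix (Fin n) (Fin p) ℝ) (Xt : Matrix (Fin m) (Fin p) ℝ) :
    Matrix (Fin n ⊕ Fin m) (Fin p) ℝ :=
  Matrix.fromRows X (Real.sqrt (η * n / m) • Xt)

/-- The stacked vector `[v; √(ηn/m)·vt]` (with `n, m` the two pool sizes). -/
def stackV (η : ℝ) (n m : ℕ) (v : Fin n → ℝ) (vt : Fin m → ℝ) : Fin n ⊕ Fin m → ℝ :=
  Sum.elim v fun i => Real.sqrt (η * n / m) * vt i

/-- `P̄`: the submatrix of `P_{X'}^⊥` obtained by deleting the last `m` columns. -/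
def Pbar (η : ℝ) (X : Matrix (Fin n) (Fin p) ℝ) (Xt : Matrix (Fin m) (Fin p) ℝ) :
    Matrix (Fin n ⊕ Fin m) (Fin n) ℝ :=
  (projPerp (stackM η X Xt)).submatrix id Sum.inl

/-- The two-pool Lasso objective `γ ↦ (1/(2n))‖P_{X'}^⊥ y' − P̄γ‖₂² + λ‖γ‖₁`. -/
def lassoObj2 (η lam : ℝ) (X : Matrix (Fin n) (Fin p) ℝ) (Xt : Matrix (Fin m) (Fin p) ℝ)
    (y : Fin n → ℝ) (yt : Fin m → ℝ) (γ : Fin n → ℝ) : ℝ :=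
  (1 / (2 * (n : ℝ))) *
      sqNorm ((projPerp (stackM η X Xt)).mulVec (stackV η n m y yt) - (Pbar η X Xt).mulVec γ)
    + lam * norm1 γ

/-- The one-pool Lasso objective `γ ↦ (1/(2n))‖P_X^⊥ y − P_X^⊥ γ‖₂² + λ‖γ‖₁`. -/
def lassoObj1 (lam : ℝ) (X : Matrix (Fin n) (Fin p) ℝ) (y : Fin n → ℝ) (γ : Fin n → ℝ) : ℝ :=
  (1 / (2 * (n : ℝ))) * sqNorm ((projPerp X).mulVec y - (projPerp X).mulVec γ) + lam * norm1 γ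

/-- The `T × T` block of `P_{X'}^⊥`. -/
def blockTT (η : ℝ) (X : Matrix (Fin n) (Fin p) ℝ) (Xt : Matrix (Fin m) (Fin p) ℝ)
    (T : Finset (Fin n)) : Matrix ↥T ↥T ℝ :=
  (projPerp (stackM η X Xt)).submatrix (fun i => Sum.inl i.1) (fun j => Sum.inl j.1)

/-- The `T^c × T` block of `P_{X'}^⊥`. -/
def blockTcT (η : ℝ) (X : Matrix (Fin n) (Fin p) ℝ) (Xt : Matrix (Fin m) (Fin p) ℝ)
    (T : Finset (Fin n)) : Matrix {i : Fin n // i ∉ T} ↥T ℝ :=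
  (projPerp (stackM η X Xt)).submatrix (fun i => Sum.inl i.1) (fun j => Sum.inl j.1)

/-- The `T × ·` block (rows indexed by `T`) of `P_{X'}^⊥`. -/
def blockTdot (η : ℝ) (X : Matrix (Fin n) (Fin p) ℝ) (Xt : Matrix (Fin m) (Fin p) ℝ)
    (T : Finset (Fin n)) : Matrix ↥T (Fin n ⊕ Fin m) ℝ :=
  (projPerp (stackM η X Xt)).submatrix (fun i => Sum.inl i.1) id

/-- Columns of `P̄` indexed by `T`. -/
def PbarT (η : ℝ) (X : Matrix (Fin n) (Fin p) ℝ) (Xt : Matrix (Fin m) (Fin p) ℝ)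
    (T : Finset (Fin n)) : Matrix (Fin n ⊕ Fin m) ↥T ℝ :=
  (Pbar η X Xt).submatrix id (fun j => j.1)

/-- Columns of `P̄` indexed by `T^c`. -/
def PbarTc (η : ℝ) (X : Matrix (Fin n) (Fin p) ℝ) (Xt : Matrix (Fin m) (Fin p) ℝ)
    (T : Finset (Fin n)) : Matrix (Fin n ⊕ Fin m) {i : Fin n // i ∉ T} ℝ :=
  (Pbar η X Xt).submatrix id (fun j => j.1)

/-- `G'(λ)` from the support recovery theorems. -/
def Gprime (η lam : ℝ) (X : Matrix (Fin n) (Fin p) ℝ) (Xt : Matrix (Fin m) (Fin p) ℝ)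
    (T : Finset (Fin n)) (εp : Fin n ⊕ Fin m → ℝ) : ℝ :=
  normInf ((blockTT η X Xt T)⁻¹.mulVec ((blockTdot η X Xt T).mulVec εp))
    + (n : ℝ) * lam * matNormInf (blockTT η X Xt T)⁻¹

/-- The lower bound on the regularization parameter in the support recovery theorems. -/
def lamLB (η : ℝ) (X : Matrix (Fin n) (Fin p) ℝ) (Xt : Matrix (Fin m) (Fin p) ℝ)
    (T : Finset (Fin n)) (αp : ℝ) (εp : Fin n ⊕ Fin m → ℝ) : ℝ :=
  (2 / (1 - αp)) * normInf ((PbarTc η X Xt T)ᵀ.mulVec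
    ((1 - PbarT η X Xt T * ((PbarT η X Xt T)ᵀ * PbarT η X Xt T)⁻¹ * (PbarT η X Xt T)ᵀ).mulVec
      ((n : ℝ)⁻¹ • εp)))

/-- One-pool `T × T` block of `P_X^⊥`. -/
def blockTT1 (X : Matrix (Fin n) (Fin p) ℝ) (T : Finset (Fin n)) : Matrix ↥T ↥T ℝ :=
  (projPerp X).submatrix (fun i => i.1) (fun j => j.1)

/-- One-pool `T^c × T` block of `P_X^⊥`. -/
def blockTcT1 (X : Matrix (Fin n) (Fin p) ℝ) (T : Finset (Fin n)) :
    Matrix {i : Fin n // i ∉ T} ↥T ℝ :=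
  (projPerp X).submatrix (fun i => i.1) (fun j => j.1)

/-- One-pool `T × ·` block of `P_X^⊥`. -/
def blockTdot1 (X : Matrix (Fin n) (Fin p) ℝ) (T : Finset (Fin n)) : Matrix ↥T (Fin n) ℝ :=
  (projPerp X).submatrix (fun i => i.1) id

/-- A real random variable `Z` is (mean-zero) sub-Gaussian with variance parameter `σ2`. -/
def IsSubG {Ω : Type*} [MeasurableSpace Ω] (μ : Measure Ω) (Z : Ω → ℝ) (σ2 : ℝ) : Prop :=
  ∀ s : ℝ, ∫ ω, Real.exp (s * Z ω) ∂μ ≤ Real.exp (σ2 * s ^ 2 / 2)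

/-- A random vector `Z` is sub-Gaussian with parameter `σ2`. -/
def IsSubGVec {Ω : Type*} [MeasurableSpace Ω] (μ : Measure Ω) {p : ℕ}
    (Z : Ω → Fin p → ℝ) (σ2 : ℝ) : Prop :=
  ∀ u : Fin p → ℝ, sqNorm u = 1 → IsSubG μ (fun ω => ∑ j, u j * Z ω j) σ2

end Debug

namespace Debug

lemma mul_mul_transpose_apply {ι κ : Type*} [Fintype κ] (A : Matrix ι κ ℝ) (M : Matrix κ κ ℝ)
    (i j : ι) :
    (A * M * Aᵀ) i j = A i ⬝ᵥ M *ᵥ A j := by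
  rw [mul_apply', dotProduct_mulVec]
  rfl

section

variable {ι κ : Type*} [Fintype ι] [Fintype κ]

lemma sqNorm_eq_dotProduct (v : ι → ℝ) : sqNorm v = v ⬝ᵥ v := by
  simp [sqNorm, dotProduct, sq]

lemma sqNorm_nonneg (v : ι → ℝ) : 0 ≤ sqNorm v :=
  Finset.sum_nonneg fun _ _ => sq_nonneg _

lemma sq_dotProduct_le (u v : ι → ℝ) : (u ⬝ᵥ v) ^ 2 ≤ sqNorm u * sqNorm v :=
  Finset.sum_mul_sq_le_sq_mul_sq _ _ _

lemma abs_le_matNormMax (M : Matrix ι κ ℝ) (i : ι) (j : κ) : |M i j| ≤ matNormMax M :=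
  (le_ciSup (Finite.bddAbove_range fun j => |M i j|) j).trans
    (le_ciSup (Finite.bddAbove_range fun i => ⨆ j, |M i j|) i)

lemma sqNorm_mulVec_le (M : Matrix ι κ ℝ) (v : κ → ℝ) :
    sqNorm (M *ᵥ v) ≤ (∑ i, sqNorm (M i)) * sqNorm v := by
  rw [Finset.sum_mul]
  exact Finset.sum_le_sum fun i _ => sq_dotProduct_le (M i) v

lemma sqrt_sqNorm_mulVec_le_specNorm (M : Matrix ι κ ℝ) {v : κ → ℝ} (hv : sqNorm v ≤ 1) :
    Real.sqrt (sqNorm (M *ᵥ v)) ≤ specNorm M := by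
  refine le_ciSup (f := fun v : {v : κ → ℝ // sqNorm v ≤ 1} => Real.sqrt (sqNorm (M *ᵥ v.1)))
    ⟨Real.sqrt (∑ i, sqNorm (M i)), ?_⟩ ⟨v, hv⟩
  rintro _ ⟨w, rfl⟩
  refine Real.sqrt_le_sqrt ((sqNorm_mulVec_le M w.1).trans ?_)
  exact mul_le_of_le_one_right (Finset.sum_nonneg fun i _ => sqNorm_nonneg (M i)) w.2

lemma abs_dotProduct_mulVec_le_specNorm (M : Matrix ι ι ℝ) {v : ι → ℝ} (hv : sqNorm v = 1) :
    |v ⬝ᵥ M *ᵥ v| ≤ specNorm M := by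
  refine le_trans (Real.abs_le_sqrt ?_) (sqrt_sqNorm_mulVec_le_specNorm M hv.le)
  simpa [hv] using sq_dotProduct_le v (M *ᵥ v)

lemma minEig_le_dotProduct_mulVec {S : Matrix ι ι ℝ} (hS : S.PosSemidef) {v : ι → ℝ}
    (hv : sqNorm v = 1) : minEig S ≤ v ⬝ᵥ S *ᵥ v := by
  refine ciInf_le (f := fun v : {v : ι → ℝ // sqNorm v = 1} => v.1 ⬝ᵥ S *ᵥ v.1)
    ⟨0, ?_⟩ ⟨v, hv⟩
  rintro _ ⟨w, rfl⟩
  simpa using hS.dotProduct_mulVec_nonneg w.1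

lemma dotProduct_mulVec_le_of_sqNorm_eq_one {A B : Matrix ι ι ℝ}
    (h : ∀ v, sqNorm v = 1 → v ⬝ᵥ A *ᵥ v ≤ v ⬝ᵥ B *ᵥ v) (v : ι → ℝ) :
    v ⬝ᵥ A *ᵥ v ≤ v ⬝ᵥ B *ᵥ v := by
  rcases eq_or_ne v 0 with rfl | hv
  · simp
  have hpos : 0 < sqNorm v := by
    rw [sqNorm_eq_dotProduct]
    exact (by simpa using dotProduct_star_self_nonneg v : 0 ≤ v ⬝ᵥ v).lt_of_ne'
      (by simpa [dotProduct_self_eq_zero] using hv)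
  set r := (Real.sqrt (sqNorm v))⁻¹ with hr
  have hr2 : r * r = (sqNorm v)⁻¹ := by
    rw [hr, ← mul_inv, Real.mul_self_sqrt hpos.le]
  have hr0 : 0 < r * r := hr2 ▸ inv_pos.mpr hpos
  have h1 : sqNorm (r • v) = 1 := by
    rw [sqNorm_eq_dotProduct, smul_dotProduct, dotProduct_smul, smul_smul, hr2,
      ← sqNorm_eq_dotProduct, smul_eq_mul, inv_mul_cancel₀ hpos.ne']
  have h2 := h _ h1
  simp only [mulVec_smul, smul_dotProduct, dotProduct_smul, smul_eq_mul, ← mul_assoc] at h2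
  exact le_of_mul_le_mul_left h2 hr0

lemma dotProduct_mulVec_le_two_mul_of_specNorm_sub_le {S A : Matrix ι ι ℝ} (hS : S.PosSemidef)
    (h : specNorm (A - S) ≤ minEig S / 2) (v : ι → ℝ) :
    v ⬝ᵥ S *ᵥ v ≤ 2 * (v ⬝ᵥ A *ᵥ v) := by
  have key := dotProduct_mulVec_le_of_sqNorm_eq_one (A := S) (B := (2 : ℝ) • A) ?_ v
  · simpa [smul_mulVec, dotProduct_smul] using key
  intro v hv
  have h1 := (abs_le.mp (abs_dotProduct_mulVec_le_specNorm (A - S) hv)).1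
  have h2 := minEig_le_dotProduct_mulVec hS hv
  simp only [sub_mulVec, dotProduct_sub, smul_mulVec, dotProduct_smul, smul_eq_mul] at h1 ⊢
  linarith

lemma abs_apply_le_of_posSemidef {M : Matrix ι ι ℝ} (hM : M.PosSemidef) {b : ℝ}
    (hb : ∀ i, M i i ≤ b) (i j : ι) : |M i j| ≤ b := by
  classical
  have hsymm : M j i = M i j := by simpa using hM.isHermitian.apply i j
  have h1 := hM.dotProduct_mulVec_nonneg (Pi.single i 1 + Pi.single j 1)
  have h2 := hM.dotProduct_mulVec_nonneg (Pi.single i 1 - Pi.single j 1)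
  simp [mulVec_add, mulVec_sub, add_dotProduct, sub_dotProduct, hsymm] at h1 h2
  rw [abs_le]
  constructor <;> linarith [hb i, hb j]

variable [DecidableEq ι] [DecidableEq κ]

lemma dotProduct_inv_mulVec_le {S G : Matrix ι ι ℝ} (hS : S.PosDef) (hG : G.PosDef) {a : ℝ}
    (h : ∀ v, v ⬝ᵥ S *ᵥ v ≤ a * (v ⬝ᵥ G *ᵥ v)) (ha : 0 < a) (x : ι → ℝ) :
    x ⬝ᵥ G⁻¹ *ᵥ x ≤ a * (x ⬝ᵥ S⁻¹ *ᵥ x) := by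
  set w := G⁻¹ *ᵥ x with hw
  set y := S⁻¹ *ᵥ x with hy
  have hGw : G *ᵥ w = x := by
    rw [hw, mulVec_mulVec, mul_nonsing_inv _ (isUnit_iff_isUnit_det _ |>.mp hG.isUnit),
      one_mulVec]
  have hSy : S *ᵥ y = x := by
    rw [hy, mulVec_mulVec, mul_nonsing_inv _ (isUnit_iff_isUnit_det _ |>.mp hS.isUnit),
      one_mulVec]
  have h1 := hS.posSemidef.dotProduct_mulVec_nonneg (w - a • y)
  have h2 := h w
  have h3 : y ⬝ᵥ S *ᵥ w = w ⬝ᵥ x := by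
    have hT : Sᵀ = S := by simpa [IsSymm] using hS.isHermitian
    rw [dotProduct_mulVec, ← mulVec_transpose, hT, hSy, dotProduct_comm]
  rw [hGw] at h2
  simp only [star_trivial, mulVec_sub, mulVec_smul, sub_dotProduct, dotProduct_sub,
    smul_dotProduct, dotProduct_smul, smul_eq_mul, hSy, h3] at h1
  rw [dotProduct_comm x w, dotProduct_comm x y]
  nlinarith

lemma matNormMax_projPerp_sub_le [Nonempty ι] {A : Matrix ι κ ℝ} {S : Matrix κ κ ℝ}
    (hS : S.PosDef) {a q b : ℝ} (ha : 0 < a) (hq : 0 ≤ q)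
    (h : ∀ v, v ⬝ᵥ S *ᵥ v ≤ a * (v ⬝ᵥ (Aᵀ * A) *ᵥ v))
    (hb : ∀ i, (A * S⁻¹ * Aᵀ) i i ≤ b) :
    matNormMax (projPerp A - (1 - q) • (1 : Matrix ι ι ℝ)) ≤ a * b + q := by
  have hG : (Aᵀ * A).PosDef := by
    refine .of_dotProduct_mulVec_pos ?_ fun x hx => ?_
    · simpa using (posSemidef_conjTranspose_mul_self A).isHermitian
    · have h1 := hS.dotProduct_mulVec_pos hx
      simp only [star_trivial] at h1 ⊢
      exact pos_of_mul_pos_right (h1.trans_le (h x)) ha.le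
  have hP : (proj A).PosSemidef := by
    simpa [proj] using hG.posSemidef.inv.mul_mul_conjTranspose_same A
  have hdiag (i : ι) : proj A i i ≤ a * b := by
    rw [proj, mul_mul_transpose_apply]
    refine (dotProduct_inv_mulVec_le hS hG h ha (A i)).trans ?_
    rw [← mul_mul_transpose_apply]
    exact mul_le_mul_of_nonneg_left (hb i) ha.le
  refine ciSup_le fun i => ciSup_le fun j => ?_
  have h1 := abs_apply_le_of_posSemidef hP hdiag i j
  have h2 : |q * (1 : Matrix ι ι ℝ) i j| ≤ q := by
    by_cases hij : i = j <;> simp [hij, one_apply, abs_of_nonneg hq, hq]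
  calc |(projPerp A - (1 - q) • (1 : Matrix ι ι ℝ)) i j|
      = |q * (1 : Matrix ι ι ℝ) i j - proj A i j| := by
        simp only [projPerp, Matrix.sub_apply, Matrix.smul_apply, smul_eq_mul]
        ring_nf
    _ ≤ |q * (1 : Matrix ι ι ℝ) i j| + |proj A i j| := abs_sub _ _
    _ ≤ a * b + q := by linarith

end

lemma mul_max_sqrt_div_eq {p L : ℝ} (hp : 0 < p) :
    p * max (Real.sqrt (L / p)) (L / p) = max (Real.sqrt (p * L)) L := by
  rw [mul_max_of_nonneg _ _ hp.le, mul_div_cancel₀ _ hp.ne']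
  congr 1
  nth_rewrite 1 [← Real.sqrt_sq hp.le]
  rw [← Real.sqrt_mul (sq_nonneg p)]
  congr 1
  field_simp

/-- under design-matrix concentration, `P_{X_S}^⊥` is entrywise close
to `(1 − p/(n−l))·I` (Lemma: PXmax). -/
theorem statement_18 :
    ∀ c lamlo lamhi : ℝ, 0 < c → 0 < lamlo → lamlo ≤ lamhi →
    ∃ C : ℝ, 0 < C ∧
      ∀ (n l p : ℕ), l < n → 0 < p →
      ∀ (XS : Matrix (Fin (n - l)) (Fin p) ℝ) (Sig : Matrix (Fin p) (Fin p) ℝ),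
        Sig.PosDef →
        lamlo ≤ minEig Sig → maxEig Sig ≤ lamhi →
        matNormMax ((((p : ℝ))⁻¹ • (XS * Sig⁻¹ * XSᵀ)) - 1) ≤
          c * max (Real.sqrt (Real.log ((n : ℝ) - l) / p)) (Real.log ((n : ℝ) - l) / p) →
        specNorm ((((n : ℝ) - l)⁻¹ • (XSᵀ * XS)) - Sig) ≤ minEig Sig / 2 →
        matNormMax (projPerp XS - (1 - (p : ℝ) / ((n : ℝ) - l)) • (1 : Matrix (Fin (n - l)) (Fin (n - l)) ℝ)) ≤
          C * max (p : ℝ) (max (Real.sqrt ((p : ℝ) * Real.log ((n : ℝ) - l)))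
              (Real.log ((n : ℝ) - l))) / ((n : ℝ) - l) := by
  intro c lamlo lamhi hc _ _
  refine ⟨3 + 2 * c, by positivity, fun n l p hl hp XS Sig hS _ _ hmax hspec => ?_⟩
  have hN : (0 : ℝ) < (n : ℝ) - l := sub_pos.mpr (Nat.cast_lt.mpr hl)
  have hp' : (0 : ℝ) < p := Nat.cast_pos.mpr hp
  have : Nonempty (Fin (n - l)) := ⟨⟨0, Nat.sub_pos_of_lt hl⟩⟩
  set N : ℝ := (n : ℝ) - l
  set m := max (Real.sqrt ((p : ℝ) * Real.log N)) (Real.log N)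
  have hquad (v : Fin p → ℝ) : v ⬝ᵥ Sig *ᵥ v ≤ 2 / N * (v ⬝ᵥ (XSᵀ * XS) *ᵥ v) := by
    have := dotProduct_mulVec_le_two_mul_of_specNorm_sub_le hS.posSemidef hspec v
    rw [smul_mulVec, dotProduct_smul, smul_eq_mul] at this
    rwa [div_eq_mul_inv, mul_assoc]
  have hdiag (i : Fin (n - l)) : (XS * Sig⁻¹ * XSᵀ) i i ≤ p + c * m := by
    have h1 := (le_abs_self _).trans ((abs_le_matNormMax _ i i).trans hmax)
    simp only [Matrix.sub_apply, Matrix.smul_apply, smul_eq_mul, one_apply_eq] at h1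
    have h2 := mul_le_mul_of_nonneg_left h1 hp'.le
    rw [mul_sub, mul_inv_cancel_left₀ hp'.ne', mul_left_comm, mul_max_sqrt_div_eq hp'] at h2
    linarith
  refine (matNormMax_projPerp_sub_le hS (by positivity) (by positivity) hquad hdiag).trans ?_
  have hm : m ≤ max (p : ℝ) m := le_max_right _ _
  have hpm : (p : ℝ) ≤ max (p : ℝ) m := le_max_left _ _
  rw [div_mul_eq_mul_div, ← add_div]
  gcongr
  nlinarith

end Debug
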